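/- Let τ > 0 be the time step, d^s > 0 the safety distance, and let d, v : ℕ → ℝ be sequences satisfying the Euler update d(t+1) = d(t) + τ·v(t) for all t. Suppose that for every t the free-space agreement holds: if d(t) ≥ 0 then v(t) ≥ -(d(t) - d^s)/(2τ), and if d(t) ≤ 0 then v(t) ≤ -(d(t) + d^s)/(2τ). If |d(0)| ≥ d^s, then for every t ∈ ℕ one has |d(t)| ≥ d^s and d(t+1)·d(t) ≥ 0 (the pair of vehicles is longitudinally safe: the safety distance is maintained and the vehicles never swap longitudinal order). -/

import Mathlib

/-- Longitudinal safety under the free-space agreement: with Euler dynamics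
`d (t+1) = d t + τ * v t`, if the free-space agreement holds at every step and
the initial distance satisfies `|d 0| ≥ dˢ`, then the safety distance is
maintained forever and the relative distance never changes sign. -/
theorem longitudinal_safety
    (τ ds : ℝ) (hτ : 0 < τ) (hds : 0 < ds)
    (d v : ℕ → ℝ)
    (heuler : ∀ t : ℕ, d (t + 1) = d t + τ * v t)
    (hagree : ∀ t : ℕ,
      (d t ≥ 0 → v t ≥ -(d t - ds) / (2 * τ)) ∧
      (d t ≤ 0 → v t ≤ -(d t + ds) / (2 * τ)))
    (h0 : |d 0| ≥ ds) :
    ∀ t : ℕ, |d t| ≥ ds ∧ d (t + 1) * d t ≥ 0 := by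
  have step_nonneg : ∀ t, ds ≤ d t → ds ≤ d (t + 1) := by
    intro t ht
    have hv := (hagree t).1 (hds.le.trans ht)
    rw [ge_iff_le, div_le_iff₀ (by positivity)] at hv
    rw [heuler]
    linarith
  have step_nonpos : ∀ t, d t ≤ -ds → d (t + 1) ≤ -ds := by
    intro t ht
    have hv := (hagree t).2 (by linarith)
    rw [le_div_iff₀ (by positivity)] at hv
    rw [heuler]
    linarith
  have safe : ∀ t, ds ≤ |d t| := by
    intro t
    induction t with
    | zero => exact h0
    | succ t ih =>
      rcases le_abs'.1 ih with h | h
      · exact le_abs'.2 (Or.inl (step_nonpos t h))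
      · exact le_abs'.2 (Or.inr (step_nonneg t h))
  intro t
  refine ⟨safe t, ?_⟩
  rcases le_abs'.1 (safe t) with h | h
  · exact mul_nonneg_of_nonpos_of_nonpos (by linarith [step_nonpos t h]) (by linarith)
  · exact mul_nonneg (by linarith [step_nonneg t h]) (by linarith)
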